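/- arXiv:2512.16326 — 2 statements merged into one kernel-verified Lean document; each statement's English description precedes it below -/
import Mathlib

section
/- Let Δ ≥ 3 be an integer, let G be a finite connected simple graph with maximum degree Δ not isomorphic to K_{Δ+1}, and let real numbers c_1, …, c_Δ satisfy 0 < c_Δ ≤ 2/(2Δ+1) and c_i = min{(1 − c_{i+1})/i, 2/(2i+1)} for 1 ≤ i ≤ Δ−1. Then α(G) ≥ Σ_{i=1}^{Δ} c_i·|V_i(G)|. -/
/-- A set of vertices is independent if its elements are pairwise nonadjacent. -/
def IsIndepSet {V : Type*} (G : SimpleGraph V) (s : Set V) : Prop :=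
  s.Pairwise fun a b => ¬ G.Adj a b

/-- The independence number: the largest cardinality of an independent set of vertices. -/
noncomputable def indepNum {V : Type*} [Fintype V] (G : SimpleGraph V) : ℕ :=
  sSup {n | ∃ s : Finset V, IsIndepSet G ↑s ∧ s.card = n}

open Finset in
theorem IsIndepSet.card_le_indepNum {V : Type*} [Fintype V] {G : SimpleGraph V} {s : Finset V}
    (hs : IsIndepSet G ↑s) : s.card ≤ indepNum G := by
  refine le_csSup ⟨Fintype.card V, ?_⟩ ⟨s, hs, rfl⟩
  rintro n ⟨t, -, rfl⟩
  exact card_le_univ t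

theorem exists_isIndepSet_card_eq_indepNum {V : Type*} [Fintype V] (G : SimpleGraph V) :
    ∃ s : Finset V, IsIndepSet G ↑s ∧ s.card = indepNum G := by
  refine Nat.sSup_mem (s := {n | ∃ s : Finset V, IsIndepSet G ↑s ∧ s.card = n})
    ⟨0, ∅, by simp [IsIndepSet], rfl⟩ ⟨Fintype.card V, ?_⟩
  rintro n ⟨t, -, rfl⟩
  exact Finset.card_le_univ t

theorem IsIndepSet.insert {V : Type*} {G : SimpleGraph V} {s : Set V} {a : V}
    (hs : IsIndepSet G s) (ha : ∀ b ∈ s, ¬ G.Adj a b) : IsIndepSet G (insert a s) :=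
  Set.Pairwise.insert hs fun b hb _ => ⟨ha b hb, fun h => ha b hb h.symm⟩

theorem SimpleGraph.Connected.mem_of_adj_closed {V : Type*} {G : SimpleGraph V}
    (hconn : G.Connected) {s : Set V} (hs : s.Nonempty)
    (hclosed : ∀ v ∈ s, ∀ w, G.Adj v w → w ∈ s) (v : V) : v ∈ s := by
  obtain ⟨u, hu⟩ := hs
  obtain ⟨p⟩ := hconn.preconnected u v
  induction p with
  | nil => exact hu
  | cons h _ ih => exact ih (hclosed _ hu _ h)

/-- A nonincreasing weight `c` with `k * c k + c (k + 1) ≤ 1` has total at most `1` on a set of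
`k + 1` elements of degree at least `k`, one of which has degree greater than `k`. -/
theorem sum_antitone_le_one {V : Type*} {c : ℕ → ℝ} (hc : Antitone c)
    (hstep : ∀ i : ℕ, (i : ℝ) * c i + c (i + 1) ≤ 1) {d : V → ℕ} {N : Finset V} {k : ℕ}
    (hcard : N.card = k + 1) (hd : ∀ v ∈ N, k ≤ d v) {x : V} (hx : x ∈ N) (hdx : k < d x) :
    ∑ v ∈ N, c (d v) ≤ 1 := by
  classical
  rw [← Finset.add_sum_erase N _ hx]
  have h1 : c (d x) ≤ c (k + 1) := hc hdx
  have h2 : ∑ v ∈ N.erase x, c (d v) ≤ (N.erase x).card • c k :=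
    Finset.sum_le_card_nsmul _ _ _ fun v hv => hc (hd v (Finset.mem_of_mem_erase hv))
  rw [Finset.card_erase_of_mem hx, hcard, nsmul_eq_mul] at h2
  have := hstep k
  simp only [Nat.add_sub_cancel] at h2
  linarith

open Finset in
/-- In a connected nonregular graph, every nonempty set `S` of vertices has a vertex whose degree
`k` in the subgraph induced by `S` is minimum and which has, in its closed neighborhood in `S`,
a vertex of degree greater than `k` in `G`. -/
theorem exists_min_induced_degree_lt_degree {V : Type*} [Fintype V] [DecidableEq V]
    (G : SimpleGraph V) [DecidableRel G.Adj] (hconn : G.Connected)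
    (hreg : ∀ k, ¬ G.IsRegularOfDegree k) {S : Finset V} (hS : S.Nonempty) :
    ∃ u ∈ S, (∀ v ∈ S, #(G.neighborFinset u ∩ S) ≤ #(G.neighborFinset v ∩ S)) ∧
      ∃ x ∈ insert u (G.neighborFinset u ∩ S), #(G.neighborFinset u ∩ S) < G.degree x := by
  by_contra! H
  obtain ⟨u, hu, hmin⟩ := exists_min_image S (fun v => #(G.neighborFinset v ∩ S)) hS
  set k := #(G.neighborFinset u ∩ S) with hk
  have hle : ∀ v, #(G.neighborFinset v ∩ S) ≤ G.degree v := fun v =>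
    card_le_card inter_subset_left
  have hdeg : ∀ v ∈ {v | v ∈ S ∧ #(G.neighborFinset v ∩ S) = k},
      ∀ x ∈ insert v (G.neighborFinset v ∩ S), G.degree x ≤ k := by
    rintro v ⟨hv, hvk⟩ x hx
    rw [← hvk]
    exact H v hv (fun w hw => hvk ▸ hmin w hw) x hx
  have hall := hconn.mem_of_adj_closed (s := {v | v ∈ S ∧ #(G.neighborFinset v ∩ S) = k})
    ⟨u, hu, rfl⟩ (by
      rintro v hv w hvw
      have hsub : G.neighborFinset v ∩ S = G.neighborFinset v :=
        eq_of_subset_of_card_le inter_subset_left (by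
          rw [G.card_neighborFinset_eq_degree, hv.2]
          exact hdeg v hv v (mem_insert_self _ _))
      have hw : w ∈ G.neighborFinset v ∩ S := by
        rw [hsub]; simpa using hvw
      have hwS := (mem_inter.1 hw).2
      exact ⟨hwS, le_antisymm ((hle w).trans (hdeg v hv w (mem_insert_of_mem hw)))
        (hmin w hwS)⟩)
  refine hreg k fun v => le_antisymm (hdeg v (hall v) v (mem_insert_self _ _)) ?_
  rw [← (hall v).2]
  exact hle v

open Finset in
theorem exists_isIndepSet_sum_degree_le {V : Type*} [Fintype V] (G : SimpleGraph V)
    [DecidableRel G.Adj] (hconn : G.Connected) (hreg : ∀ k, ¬ G.IsRegularOfDegree k)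
    {c : ℕ → ℝ} (hc : Antitone c) (hstep : ∀ i : ℕ, (i : ℝ) * c i + c (i + 1) ≤ 1)
    (S : Finset V) :
    ∃ I ⊆ S, IsIndepSet G (I : Set V) ∧ ∑ v ∈ S, c (G.degree v) ≤ (#I : ℝ) := by
  classical
  induction S using Finset.strongInduction with
  | H S ih =>
    rcases S.eq_empty_or_nonempty with rfl | hS
    · exact ⟨∅, Subset.rfl, by simp [IsIndepSet], by simp⟩
    obtain ⟨u, hu, hmin, x, hx, hdx⟩ := exists_min_induced_degree_lt_degree G hconn hreg hS
    set N := insert u (G.neighborFinset u ∩ S) with hN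
    have hNS : N ⊆ S := insert_subset hu inter_subset_right
    have hsum : ∑ v ∈ N, c (G.degree v) ≤ 1 :=
      sum_antitone_le_one hc hstep (card_insert_of_notMem (by simp))
        (fun v hv => (hmin v (hNS hv)).trans (card_le_card inter_subset_left)) hx hdx
    obtain ⟨I, hI, hind, hIcard⟩ := ih (S \ N)
      (sdiff_ssubset hNS ⟨u, mem_insert_self _ _⟩)
    have huI : u ∉ I := fun h => (mem_sdiff.1 (hI h)).2 (mem_insert_self _ _)
    refine ⟨insert u I, insert_subset hu (hI.trans sdiff_subset), ?_, ?_⟩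
    · rw [coe_insert]
      refine hind.insert fun b hb hub => (mem_sdiff.1 (hI hb)).2 (mem_insert_of_mem ?_)
      exact mem_inter.2 ⟨by simpa using hub, (mem_sdiff.1 (hI hb)).1⟩
    · rw [card_insert_of_notMem huI, ← sum_sdiff hNS]
      push_cast
      linarith

/-- A connected `k`-regular graph in which some closed neighborhood is a clique is complete. -/
theorem nonempty_iso_top_of_isClique_neighborSet {V : Type*} [Fintype V] {G : SimpleGraph V}
    [DecidableRel G.Adj] (hconn : G.Connected) {k : ℕ} (hreg : G.IsRegularOfDegree k) {v : V}
    (hv : G.IsClique (G.neighborSet v)) :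
    Nonempty (G ≃g (⊤ : SimpleGraph (Fin (k + 1)))) := by
  classical
  have hN : ∀ x ∈ insert v (G.neighborFinset v),
      (insert v (G.neighborFinset v)).erase x = G.neighborFinset x := by
    intro x hx
    refine Finset.eq_of_subset_of_card_le (fun y hy => ?_) ?_
    · simp only [Finset.mem_erase, Finset.mem_insert, SimpleGraph.mem_neighborFinset] at hx hy ⊢
      obtain ⟨hne, rfl | hy⟩ := hy
      · rcases hx with rfl | hx
        · exact absurd rfl hne
        · exact hx.symm
      · rcases hx with rfl | hx
        · exact hy
        · exact hv hx hy (Ne.symm hne)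
    · rw [Finset.card_erase_of_mem hx, Finset.card_insert_of_notMem (by simp),
        G.card_neighborFinset_eq_degree, G.card_neighborFinset_eq_degree, hreg x, hreg v]
      simp
  have hall := hconn.mem_of_adj_closed (s := ↑(insert v (G.neighborFinset v)))
    ⟨v, by simp⟩ (fun x hx y hxy => by
      have hy : y ∈ G.neighborFinset x := by simpa using hxy
      rw [← hN x hx] at hy
      exact Finset.mem_of_mem_erase hy)
  have huniv : insert v (G.neighborFinset v) = Finset.univ :=
    Finset.eq_univ_iff_forall.2 hall
  have hcard : Fintype.card V = k + 1 := by
    rw [← Finset.card_univ, ← huniv, Finset.card_insert_of_notMem (by simp),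
      G.card_neighborFinset_eq_degree, hreg v]
  have htop : G = ⊤ := by
    ext x y
    rw [← G.mem_neighborFinset, ← hN x (hall x), huniv]
    simp [eq_comm]
  subst htop
  exact ⟨SimpleGraph.Iso.completeGraph (Fintype.equivFinOfCardEq hcard)⟩

open Finset in
/-- Fajtlowicz's bound for connected regular graphs that are not complete. -/
theorem two_mul_card_le_mul_indepNum {V : Type*} [Fintype V] {G : SimpleGraph V}
    [DecidableRel G.Adj] (hconn : G.Connected) {k : ℕ} (hreg : G.IsRegularOfDegree k)
    (hnotK : ¬ Nonempty (G ≃g (⊤ : SimpleGraph (Fin (k + 1))))) :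
    2 * Fintype.card V ≤ (2 * k + 1) * indepNum G := by
  classical
  obtain ⟨I, hI, hIcard⟩ := exists_isIndepSet_card_eq_indepNum G
  have hmax : ∀ J : Finset V, IsIndepSet G (J : Set V) → #J ≤ #I := fun J hJ =>
    hIcard ▸ hJ.card_le_indepNum
  have hdom : ∀ x ∈ Iᶜ, 1 ≤ #(G.neighborFinset x ∩ I) := by
    intro x hx
    rw [mem_compl] at hx
    by_contra! h
    have h0 : G.neighborFinset x ∩ I = ∅ := by
      rw [← card_eq_zero]; omega
    have := hmax (insert x I) (by
      rw [coe_insert]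
      refine hI.insert fun b hb hxb => ?_
      have : b ∈ G.neighborFinset x ∩ I := mem_inter.2 ⟨by simpa using hxb, hb⟩
      simp [h0] at this)
    rw [card_insert_of_notMem hx] at this
    omega
  let P : V → Finset V := fun v => {x ∈ Iᶜ | G.neighborFinset x ∩ I = {v}}
  have hPadj : ∀ v, ∀ x ∈ P v, G.Adj v x := by
    intro v x hx
    have : v ∈ G.neighborFinset x ∩ I := by
      rw [(mem_filter.1 hx).2]; simp
    exact ((G.mem_neighborFinset _ _).1 (mem_inter.1 this).1).symm
  have hPclique : ∀ v ∈ I, G.IsClique (P v : Set V) := by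
    intro v hv x hx y hy hxy
    by_contra hnadj
    obtain ⟨hxI, hxN⟩ := mem_filter.1 (mem_coe.1 hx)
    obtain ⟨hyI, hyN⟩ := mem_filter.1 (mem_coe.1 hy)
    rw [mem_compl] at hxI hyI
    have hnot : ∀ z, G.neighborFinset z ∩ I = {v} → ∀ b ∈ I.erase v, ¬ G.Adj z b := by
      intro z hz b hb hzb
      have : b ∈ G.neighborFinset z ∩ I :=
        mem_inter.2 ⟨by simpa using hzb, mem_of_mem_erase hb⟩
      rw [hz, mem_singleton] at this
      exact ne_of_mem_erase hb this
    have hy' : y ∉ I.erase v := fun h => hyI (mem_of_mem_erase h)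
    have hx' : x ∉ insert y (I.erase v) := by
      rw [mem_insert, not_or]
      exact ⟨hxy, fun h => hxI (mem_of_mem_erase h)⟩
    have := hmax (insert x (insert y (I.erase v))) (by
      rw [coe_insert, coe_insert]
      refine IsIndepSet.insert (IsIndepSet.insert
        (Set.Pairwise.mono (by simp) hI) (hnot y hyN)) ?_
      rintro b (rfl | hb)
      · exact hnadj
      · exact hnot x hxN b hb)
    rw [card_insert_of_notMem hx', card_insert_of_notMem hy', card_erase_of_mem hv] at this
    omega
  have hPcard : ∀ v ∈ I, #(P v) + 1 ≤ k := by
    intro v hv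
    by_contra! h
    have hsub : P v ⊆ G.neighborFinset v := fun x hx => by simpa using hPadj v x hx
    have heq : P v = G.neighborFinset v := eq_of_subset_of_card_le hsub (by
      rw [G.card_neighborFinset_eq_degree, hreg v]; omega)
    refine hnotK (nonempty_iso_top_of_isClique_neighborSet hconn hreg (v := v) ?_)
    have := hPclique v hv
    rwa [heq, SimpleGraph.coe_neighborFinset] at this
  have hcount : ∑ x ∈ Iᶜ, #(G.neighborFinset x ∩ I) = #I * k := by
    have h := sum_card_bipartiteAbove_eq_sum_card_bipartiteBelow (s := Iᶜ) (t := I) G.Adj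
    have h1 : ∀ x ∈ Iᶜ, #(bipartiteAbove G.Adj I x) = #(G.neighborFinset x ∩ I) := fun x _ => by
      congr 1; ext y; simp [bipartiteAbove, and_comm]
    have h2 : ∀ v ∈ I, #(bipartiteBelow G.Adj Iᶜ v) = k := fun v hv => by
      rw [← hreg v, ← G.card_neighborFinset_eq_degree]
      congr 1; ext y
      simp only [bipartiteBelow, mem_filter, mem_compl, SimpleGraph.mem_neighborFinset]
      exact ⟨fun h => h.2.symm, fun h => ⟨fun hy => hI hv hy h.ne h, h.symm⟩⟩
    rw [sum_congr rfl h1, sum_congr rfl h2, sum_const, smul_eq_mul] at h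
    exact h
  have hprivate : #{x ∈ Iᶜ | #(G.neighborFinset x ∩ I) = 1} ≤ ∑ v ∈ I, #(P v) := by
    refine (card_le_card (fun x hx => ?_)).trans card_biUnion_le
    obtain ⟨hxI, hx1⟩ := mem_filter.1 hx
    obtain ⟨v, hv⟩ := card_eq_one.1 hx1
    have hvI : v ∈ G.neighborFinset x ∩ I := by rw [hv]; simp
    exact mem_biUnion.2 ⟨v, (mem_inter.1 hvI).2, mem_filter.2 ⟨hxI, hv⟩⟩
  have hlower : 2 * #Iᶜ ≤
      ∑ x ∈ Iᶜ, #(G.neighborFinset x ∩ I) + #{x ∈ Iᶜ | #(G.neighborFinset x ∩ I) = 1} := by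
    rw [card_filter, ← sum_add_distrib, mul_comm, ← smul_eq_mul]
    refine card_nsmul_le_sum _ _ _ fun x hx => ?_
    have := hdom x hx
    split_ifs <;> omega
  have hupper : ∑ v ∈ I, #(P v) + #I ≤ #I * k := by
    rw [card_eq_sum_ones, ← sum_add_distrib, ← card_eq_sum_ones, ← smul_eq_mul]
    exact sum_le_card_nsmul _ _ _ hPcard
  have hn : #I + #Iᶜ = Fintype.card V := card_add_card_compl I
  rw [← hIcard, ← hn]
  nlinarith

theorem sum_degree_le_indepNum {V : Type*} [Fintype V] {G : SimpleGraph V} [DecidableRel G.Adj]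
    (hconn : G.Connected)
    (hnotK : ¬ Nonempty (G ≃g (⊤ : SimpleGraph (Fin (G.maxDegree + 1)))))
    {c : ℕ → ℝ} (hc : Antitone c) (hstep : ∀ i : ℕ, (i : ℝ) * c i + c (i + 1) ≤ 1)
    (hle : ∀ i : ℕ, c i ≤ 2 / (2 * (i : ℝ) + 1)) :
    ∑ v, c (G.degree v) ≤ (indepNum G : ℝ) := by
  by_cases hreg : ∃ k, G.IsRegularOfDegree k
  · obtain ⟨k, hk⟩ := hreg
    have := hconn.nonempty
    have hmax : G.maxDegree = k := by
      obtain ⟨v, hv⟩ := G.exists_maximal_degree_vertex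
      rw [hv, hk v]
    rw [hmax] at hnotK
    have h : (2 * Fintype.card V : ℝ) ≤ (2 * k + 1) * indepNum G := by
      exact_mod_cast two_mul_card_le_mul_indepNum hconn hk hnotK
    simp only [hk.degree_eq, Finset.sum_const, Finset.card_univ, nsmul_eq_mul]
    have hpos : (0 : ℝ) < 2 * k + 1 := by positivity
    have h1 := hle k
    rw [le_div_iff₀ hpos] at h1
    have h2 : (0 : ℝ) ≤ Fintype.card V := by positivity
    nlinarith [mul_le_mul_of_nonneg_left h1 h2]
  · push Not at hreg
    obtain ⟨I, -, hI, hsum⟩ := exists_isIndepSet_sum_degree_le G hconn hreg hc hstep Finset.univ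
    exact hsum.trans (by exact_mod_cast hI.card_le_indepNum)

theorem stmt2 (Δ : ℕ) (hΔ : 3 ≤ Δ) {V : Type*} [Fintype V]
    (G : SimpleGraph V) [DecidableRel G.Adj]
    (hconn : G.Connected) (hmax : G.maxDegree = Δ)
    (hnotK : ¬ Nonempty (G ≃g (⊤ : SimpleGraph (Fin (Δ + 1)))))
    (c : ℕ → ℝ) (hcΔpos : 0 < c Δ) (hcΔle : c Δ ≤ 2 / (2 * (Δ : ℝ) + 1))
    (hrec : ∀ i : ℕ, 1 ≤ i → i ≤ Δ - 1 →
      c i = min ((1 - c (i + 1)) / (i : ℝ)) (2 / (2 * (i : ℝ) + 1))) :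
    ∑ i ∈ Finset.Icc 1 Δ,
      c i * ((Finset.univ.filter fun v : V => G.degree v = i).card : ℝ)
      ≤ (indepNum G : ℝ) := by
  have hle : ∀ i, 1 ≤ i → i ≤ Δ → (2 * (i : ℝ) + 1) * c i ≤ 2 := by
    intro i h1 h2
    have hpos : (0 : ℝ) < 2 * i + 1 := by positivity
    rw [← le_div_iff₀' hpos]
    rcases h2.eq_or_lt with rfl | h2
    · exact hcΔle
    · rw [hrec i h1 (by omega)]
      exact min_le_right _ _
  have hstep : ∀ i : ℕ, 1 ≤ i → i < Δ → (i : ℝ) * c i + c (i + 1) ≤ 1 := by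
    intro i h1 h2
    have hpos : (0 : ℝ) < i := by exact_mod_cast h1
    have h := min_le_left ((1 - c (i + 1)) / (i : ℝ)) (2 / (2 * (i : ℝ) + 1))
    rw [← hrec i h1 (by omega), le_div_iff₀' hpos] at h
    linarith
  have hanti : ∀ i : ℕ, 1 ≤ i → i < Δ → c (i + 1) ≤ c i := by
    intro i h1 h2
    have hpos : (0 : ℝ) < i := by exact_mod_cast h1
    have h := hle (i + 1) (by omega) h2
    push_cast at h
    rw [hrec i h1 (by omega)]
    refine le_min ?_ ?_
    · rw [le_div_iff₀' hpos]
      nlinarith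
    · rw [le_div_iff₀' (by positivity)]
      nlinarith
  let c' : ℕ → ℝ := fun i => if i = 0 then 1 else if i ≤ Δ then c i else 0
  have hzero : c' 0 = 1 := rfl
  have hin : ∀ i, 1 ≤ i → i ≤ Δ → c' i = c i := fun i h1 h2 => by
    simp [c', h2, Nat.one_le_iff_ne_zero.1 h1]
  have hout : ∀ i, Δ < i → c' i = 0 := fun i h => by
    simp [c', Nat.not_le.2 h, Nat.ne_of_gt (Nat.zero_lt_of_lt h)]
  have hanti' : Antitone c' := by
    refine antitone_nat_of_succ_le fun i => ?_
    rcases Nat.eq_zero_or_pos i with rfl | h1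
    · rw [hzero, hin 1 le_rfl (by omega)]
      have := hle 1 le_rfl (by omega)
      norm_num at this
      linarith
    rcases lt_trichotomy i Δ with h | rfl | h
    · rw [hin i h1 h.le, hin (i + 1) (by omega) h]
      exact hanti i h1 h
    · rw [hin i h1 le_rfl, hout (i + 1) (by omega)]
      exact hcΔpos.le
    · rw [hout i h, hout (i + 1) (by omega)]
  have hnonneg : ∀ i, 0 ≤ c' i := fun i => by
    have := hanti' (show i ≤ i + (Δ + 1) by omega)
    rwa [hout (i + (Δ + 1)) (by omega)] at this
  have hstep' : ∀ i : ℕ, (i : ℝ) * c' i + c' (i + 1) ≤ 1 := by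
    intro i
    rcases Nat.eq_zero_or_pos i with rfl | h1
    · have := hanti' (show 0 ≤ 0 + 1 by omega)
      rw [hzero] at this
      simpa using this
    rcases lt_trichotomy i Δ with h | rfl | h
    · rw [hin i h1 h.le, hin (i + 1) (by omega) h]
      exact hstep i h1 h
    · rw [hin i h1 le_rfl, hout (i + 1) (by omega)]
      linarith [hle i h1 le_rfl]
    · rw [hout i h, hout (i + 1) (by omega)]
      norm_num
  have hle' : ∀ i : ℕ, c' i ≤ 2 / (2 * (i : ℝ) + 1) := by
    intro i
    rcases Nat.eq_zero_or_pos i with rfl | h1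
    · rw [hzero]; norm_num
    rcases le_or_gt i Δ with h | h
    · rw [hin i h1 h, le_div_iff₀' (by positivity)]
      exact hle i h1 h
    · rw [hout i h]; positivity
  subst hmax
  refine le_trans ?_ (sum_degree_le_indepNum hconn hnotK hanti' hstep' hle')
  have hfiber : ∀ i ∈ Finset.Icc 1 G.maxDegree,
      c i * ((Finset.univ.filter fun v : V => G.degree v = i).card : ℝ) =
        ∑ v with G.degree v = i, c' (G.degree v) := by
    intro i hi
    rw [Finset.mem_Icc] at hi
    rw [Finset.sum_congr rfl fun v hv => by rw [(Finset.mem_filter.1 hv).2, hin i hi.1 hi.2],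
      Finset.sum_const, nsmul_eq_mul, mul_comm]
  rw [Finset.sum_congr rfl hfiber]
  exact Finset.sum_fiberwise_le_sum_of_sum_fiber_nonneg
    fun i _ => Finset.sum_nonneg fun v _ => hnonneg _
end

section
/- For every odd integer i ≥ 1, the infinite series Σ_{j=1}^{∞} 1/(i·(i+1)⋯(i+2j)) converges and equals (i−1)!·((e − 1/e)/2 − Σ_{j=0}^{(i−1)/2} 1/(2j+1)!), and the infinite series Σ_{j=1}^{∞} 1/(i·(i+1)⋯(i+2j+1)) converges and equals (i−1)!·((e + 1/e)/2 − Σ_{j=0}^{(i+1)/2} 1/(2j)!). -/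
theorem factorial_mul_prod_Icc_cast (a n : ℕ) :
    (Nat.factorial a : ℝ) * ∏ k ∈ Finset.Icc (a + 1) (a + n), (k : ℝ) =
      Nat.factorial (a + n) := by
  induction n with
  | zero => simp
  | succ n ih =>
    rw [← add_assoc, Finset.prod_Icc_succ_top (by omega), ← mul_assoc, ih, Nat.factorial_succ]
    push_cast
    ring

theorem one_div_prod_Icc_cast (a n : ℕ) :
    1 / ∏ k ∈ Finset.Icc (a + 1) (a + n), (k : ℝ) =
      Nat.factorial a * (1 / (Nat.factorial (a + n) : ℝ)) := by
  have ha : (Nat.factorial a : ℝ) ≠ 0 := mod_cast Nat.factorial_ne_zero a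
  rw [← factorial_mul_prod_Icc_cast, ← div_eq_mul_one_div, ← div_div, div_self ha]

theorem stmt18 (i : ℕ) (hi : 1 ≤ i) (hodd : Odd i) :
    HasSum (fun j : ℕ => 1 / ∏ k ∈ Finset.Icc i (i + 2 * (j + 1)), (k : ℝ))
      ((Nat.factorial (i - 1) : ℝ) *
        ((Real.exp 1 - 1 / Real.exp 1) / 2
          - ∑ j ∈ Finset.range ((i - 1) / 2 + 1), 1 / (Nat.factorial (2 * j + 1) : ℝ))) ∧
    HasSum (fun j : ℕ => 1 / ∏ k ∈ Finset.Icc i (i + 2 * (j + 1) + 1), (k : ℝ))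
      ((Nat.factorial (i - 1) : ℝ) *
        ((Real.exp 1 + 1 / Real.exp 1) / 2
          - ∑ j ∈ Finset.range ((i + 1) / 2 + 1), 1 / (Nat.factorial (2 * j) : ℝ))) := by
  obtain ⟨m, rfl⟩ := hodd
  have hs : HasSum (fun n : ℕ => 1 / (Nat.factorial (2 * n + 1) : ℝ))
      ((Real.exp 1 - 1 / Real.exp 1) / 2) := by
    simpa [Real.sinh_eq, Real.exp_neg] using Real.hasSum_sinh 1
  have hc : HasSum (fun n : ℕ => 1 / (Nat.factorial (2 * n) : ℝ))
      ((Real.exp 1 + 1 / Real.exp 1) / 2) := by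
    simpa [Real.cosh_eq, Real.exp_neg] using Real.hasSum_cosh 1
  have h₁ : (2 * m + 1 - 1) / 2 + 1 = m + 1 := by omega
  have h₂ : (2 * m + 1 + 1) / 2 + 1 = m + 2 := by omega
  rw [h₁, h₂, Nat.add_sub_cancel]
  constructor
  · have h := ((hasSum_nat_add_iff' (m + 1)).mpr hs).mul_left (Nat.factorial (2 * m) : ℝ)
    refine (congrArg (HasSum · _) (funext fun j => ?_)).mpr h
    rw [show 2 * m + 1 + 2 * (j + 1) = 2 * m + (2 * j + 3) by ring, one_div_prod_Icc_cast,
      show 2 * m + (2 * j + 3) = 2 * (j + (m + 1)) + 1 by ring]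
  · have h := ((hasSum_nat_add_iff' (m + 2)).mpr hc).mul_left (Nat.factorial (2 * m) : ℝ)
    refine (congrArg (HasSum · _) (funext fun j => ?_)).mpr h
    rw [show 2 * m + 1 + 2 * (j + 1) + 1 = 2 * m + (2 * j + 4) by ring, one_div_prod_Icc_cast,
      show 2 * m + (2 * j + 4) = 2 * (j + (m + 2)) by ring]
end
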